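/- arXiv:2305.10051 — 3 statements merged into one kernel-verified Lean document; each statement's English description precedes it below -/
import Mathlib

section
/- Let n ≥ 1, let ε ≥ 0, set α = exp(ε/2), and let u, u₀ : Fin n → ℝ with u₀ j > 0 and u j > 0 for every j. If u₀ j / α ≤ u j ≤ u₀ j · α for every j, then CD(u, u₀) ≤ ε, where CD(u, u₀) = (max over j of ln(u j / u₀ j)) − (min over j of ln(u j / u₀ j)). (Correctness of the CD-distance region-expansion scheme: every instantiation in the multiplicatively expanded box ∏_j [u₀ j · α⁻¹, u₀ j · α] is ε-close to u₀ in CD distance.) -/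
/-- The Chan–Darwiche (CD) distance between two strictly positive
instantiations `u v : Fin n → ℝ`, for `n ≥ 1`. -/
noncomputable def CD {n : ℕ} (hn : 1 ≤ n) (u v : Fin n → ℝ) : ℝ :=
  Finset.univ.sup' (Finset.univ_nonempty_iff.mpr ⟨⟨0, hn⟩⟩)
      (fun j => Real.log (u j / v j)) -
    Finset.univ.inf' (Finset.univ_nonempty_iff.mpr ⟨⟨0, hn⟩⟩)
      (fun j => Real.log (u j / v j))

theorem cd_region_expansion (n : ℕ) (hn : 1 ≤ n) (ε : ℝ) (hε : 0 ≤ ε)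
    (u u₀ : Fin n → ℝ) (hu₀ : ∀ j, 0 < u₀ j) (hu : ∀ j, 0 < u j)
    (h : ∀ j, u₀ j / Real.exp (ε / 2) ≤ u j ∧ u j ≤ u₀ j * Real.exp (ε / 2)) :
    CD hn u u₀ ≤ ε := by
  have upper : ∀ j, Real.log (u j / u₀ j) ≤ ε / 2 := fun j => by
    rw [Real.log_le_iff_le_exp (div_pos (hu j) (hu₀ j)), div_le_iff₀' (hu₀ j)]
    exact (h j).2
  have lower : ∀ j, -(ε / 2) ≤ Real.log (u j / u₀ j) := fun j => by
    rw [Real.le_log_iff_exp_le (div_pos (hu j) (hu₀ j)), le_div_iff₀' (hu₀ j),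
      Real.exp_neg, ← div_eq_mul_inv]
    exact (h j).1
  have sup_le := Finset.sup'_le (Finset.univ_nonempty_iff.mpr ⟨⟨0, hn⟩⟩)
    (fun j => Real.log (u j / u₀ j)) (fun j _ => upper j)
  have le_inf := Finset.le_inf' (Finset.univ_nonempty_iff.mpr ⟨⟨0, hn⟩⟩)
    (fun j => Real.log (u j / u₀ j)) (fun j _ => lower j)
  unfold CD
  linarith
end

section
/- Let n ≥ 1 and k ≥ 1. For each i ∈ Fin k, let lbᵢ, ubᵢ : Fin n → ℝ with lbᵢ j ≤ ubᵢ j for all j, let Rᵢ = {u : Fin n → ℝ | ∀ j, lbᵢ j ≤ u j ≤ ubᵢ j}, and let u₀ : Fin n → ℝ. Define u₊,ᵢ to be the coordinatewise clamp of u₀ to Rᵢ, i.e. u₊,ᵢ j = max (lbᵢ j) (min (u₀ j) (ubᵢ j)). Then there exists an index i* ∈ Fin k such that u₊,ᵢ* ∈ ⋃ᵢ Rᵢ and for every u ∈ ⋃ᵢ Rᵢ, √(∑_j (u₊,ᵢ* j − u₀ j)²) ≤ √(∑_j (u j − u₀ j)²). (Overall correctness of the minimal-distance instantiation algorithm: taking,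 over the finitely many rectangular accepting subregions, the clamp candidate of least Euclidean distance to u₀ yields a point of the union of the accepting regions that is closest to u₀.) -/
/-- Clamping `x` to `[a, b]` gives the point of `[a, b]` closest to `x`. -/
theorem sq_clamp_sub_le {a b x y : ℝ} (hay : a ≤ y) (hyb : y ≤ b) :
    (max a (min x b) - x) ^ 2 ≤ (y - x) ^ 2 := by
  rw [sq_le_sq]
  rcases le_total x b with hxb | hbx
  · rw [min_eq_left hxb]
    rcases le_total a x with hax | hxa
    · simp [max_eq_right hax]
    · rw [max_eq_left hxa, abs_of_nonneg (by linarith), abs_of_nonneg (by linarith)]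
      linarith
  · rw [min_eq_right hbx, max_eq_right (hay.trans hyb), abs_of_nonpos (by linarith),
      abs_of_nonpos (by linarith)]
    linarith

theorem clamp_minimizes_euclidean_on_union_of_boxes (n k : ℕ)
    (hn : 1 ≤ n) (hk : 1 ≤ k)
    (lb ub : Fin k → Fin n → ℝ) (hlu : ∀ i j, lb i j ≤ ub i j)
    (u₀ : Fin n → ℝ) :
    ∃ i : Fin k,
      (fun j => max (lb i j) (min (u₀ j) (ub i j))) ∈
          ⋃ i' : Fin k, {u : Fin n → ℝ | ∀ j, lb i' j ≤ u j ∧ u j ≤ ub i' j} ∧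
        ∀ u ∈ ⋃ i' : Fin k, {u : Fin n → ℝ | ∀ j, lb i' j ≤ u j ∧ u j ≤ ub i' j},
          Real.sqrt (∑ j, (max (lb i j) (min (u₀ j) (ub i j)) - u₀ j) ^ 2) ≤
            Real.sqrt (∑ j, (u j - u₀ j) ^ 2) := by
  have : Nonempty (Fin k) := ⟨⟨0, hk⟩⟩
  obtain ⟨i, hi⟩ := Finite.exists_min fun i : Fin k =>
    Real.sqrt (∑ j, (max (lb i j) (min (u₀ j) (ub i j)) - u₀ j) ^ 2)
  refine ⟨i, Set.mem_iUnion.2 ⟨i, fun j =>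
    ⟨le_max_left _ _, max_le (hlu i j) (min_le_right _ _)⟩⟩, fun u hu => ?_⟩
  obtain ⟨i', hu⟩ := Set.mem_iUnion.1 hu
  exact (hi i').trans <| Real.sqrt_le_sqrt <|
    Finset.sum_le_sum fun j _ => sq_clamp_sub_le (hu j).1 (hu j).2
end

section
/- Let n ≥ 1 and let u, v, w : Fin n → ℝ be strictly positive vectors. Then CD(u, w) ≤ CD(u, v) + CD(v, w), where CD(u, v) = (max over j of ln(u j / v j)) − (min over j of ln(u j / v j)). (Triangle inequality for the Chan–Darwiche distance, the axiom the paper uses to justify picking a minimum-distance instantiation from a bounded accepting region.) -/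
theorem log_div_eq_log_div_add_log_div {x y z : ℝ} (hx : x ≠ 0) (hy : y ≠ 0) (hz : z ≠ 0) :
    Real.log (x / z) = Real.log (x / y) + Real.log (y / z) := by
  rw [Real.log_div hx hz, Real.log_div hx hy, Real.log_div hy hz]
  ring

theorem Finset.sup'_add_le_add_sup' {ι : Type*} {s : Finset ι} (hs : s.Nonempty) (f g : ι → ℝ) :
    s.sup' hs (fun j => f j + g j) ≤ s.sup' hs f + s.sup' hs g :=
  Finset.sup'_le hs _ fun _ hj => add_le_add (Finset.le_sup' f hj) (Finset.le_sup' g hj)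

theorem Finset.inf'_add_inf'_le_inf'_add {ι : Type*} {s : Finset ι} (hs : s.Nonempty)
    (f g : ι → ℝ) :
    s.inf' hs f + s.inf' hs g ≤ s.inf' hs (fun j => f j + g j) :=
  Finset.le_inf' hs _ fun _ hj => add_le_add (Finset.inf'_le f hj) (Finset.inf'_le g hj)

theorem cd_triangle (n : ℕ) (hn : 1 ≤ n) (u v w : Fin n → ℝ)
    (hu : ∀ j, 0 < u j) (hv : ∀ j, 0 < v j) (hw : ∀ j, 0 < w j) :
    CD hn u w ≤ CD hn u v + CD hn v w := by
  have hlog : (fun j => Real.log (u j / w j)) =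
      fun j => Real.log (u j / v j) + Real.log (v j / w j) :=
    funext fun j => log_div_eq_log_div_add_log_div (hu j).ne' (hv j).ne' (hw j).ne'
  have hne : (Finset.univ : Finset (Fin n)).Nonempty :=
    Finset.univ_nonempty_iff.mpr ⟨⟨0, hn⟩⟩
  have hsup := Finset.sup'_add_le_add_sup' hne
    (fun j => Real.log (u j / v j)) (fun j => Real.log (v j / w j))
  have hinf := Finset.inf'_add_inf'_le_inf'_add hne
    (fun j => Real.log (u j / v j)) (fun j => Real.log (v j / w j))
  unfold CD
  rw [hlog]
  linarith
end
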